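/- Let f : E(G*) → E(S10) be an S10-coloring of G*. Then f^{-1}(A1) ∩ E2 = ∅, where A1 is the set of the six edges of S10 that lie in a pair of parallel edges, and E2 is the set of edges of G* that neither belong to the copy of the Petersen graph minus a vertex nor to any of the three attached copies of S4. -/

import Mathlib

/-- A loopless multigraph: each edge has an unordered pair of distinct endpoints.
Parallel edges are allowed. -/
structure Multigraph (V : Type) (E : Type) where
  ends : E → Sym2 V
  loopless : ∀ e, ¬ (ends e).IsDiag

namespace Multigraph

variable {V E V' E' V'' E'' : Type}

/-- `G.inc v` is the set `∂_G(v)` of edges of `G` incident with the vertex `v`. -/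
def inc (G : Multigraph V E) (v : V) : Set E := {e | v ∈ G.ends e}

/-- Two edges are adjacent if they are distinct and share an endpoint. -/
def EdgeAdj (G : Multigraph V E) (e₁ e₂ : E) : Prop :=
  e₁ ≠ e₂ ∧ ∃ v, e₁ ∈ G.inc v ∧ e₂ ∈ G.inc v

/-- `f` is an `H`-coloring of `G`: a proper edge-coloring (adjacent edges of `G` receive
distinct images) such that for every vertex `v` of `G` there is a vertex `u` of `H` with
`f(∂_G(v)) = ∂_H(u)`. -/
def IsColoring (G : Multigraph V E) (H : Multigraph V' E') (f : E → E') : Prop :=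
  (∀ e₁ e₂, G.EdgeAdj e₁ e₂ → f e₁ ≠ f e₂) ∧
  (∀ v : V, ∃ u : V', f '' G.inc v = H.inc u)

end Multigraph

/-- The Sylvester graph `S₁₀`: vertex `0` is the centre `w`; vertices `1,2,3` are
`z₁,z₂,z₃`; vertices `4,5` are `x₁,y₁`; vertices `6,7` are `x₂,y₂`; vertices `8,9` are
`x₃,y₃`.  Edges `9,…,14` are the three pairs of parallel edges. -/
def S10 : Multigraph (Fin 10) (Fin 15) where
  ends := ![s(0,1), s(0,2), s(0,3), s(1,4), s(1,5), s(2,6), s(2,7), s(3,8), s(3,9),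
            s(4,5), s(4,5), s(6,7), s(6,7), s(8,9), s(8,9)]
  loopless := by decide

/-- `A₁` is the set of the six edges of `S₁₀` lying in a pair of parallel edges. -/
def A1 : Set (Fin 15) := {9, 10, 11, 12, 13, 14}

/-- The graph `G*`.  Vertices `0,…,8` induce the Petersen graph minus a vertex `v₀`
(vertices `0`, `3`, `4` are the former neighbours of `v₀`); vertex `9` is `u`;
vertices `10`, `11` are `s₁`, `s₂`; vertices `12,13,14` form the triangle `t₁t₂t₃`;
vertices `15,…,23` are the three attached copies of `S₄` (with `17`, `20`, `23`
the vertices `c` joined to `s₁`, `s₂`, `t₃` respectively).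
Edges `0,…,11` form `E₁` (the copy of the Petersen graph minus a vertex),
edges `12,…,23` form `E₂`, and edges `24,…,35` are the edges of the copies of `S₄`. -/
def Gstar : Multigraph (Fin 24) (Fin 36) where
  ends := ![s(0,1), s(1,2), s(2,3), s(0,5), s(1,6), s(2,7), s(3,8), s(4,6), s(4,7),
            s(5,7), s(5,8), s(6,8),
            s(9,10), s(9,11), s(9,12), s(12,13), s(13,14), s(12,14),
            s(10,0), s(11,3), s(13,4), s(10,17), s(11,20), s(14,23),
            s(15,16), s(15,16), s(15,17), s(16,17),
            s(18,19), s(18,19), s(18,20), s(19,20),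
            s(21,22), s(21,22), s(21,23), s(22,23)]
  loopless := by decide

/-- `E₁`: the edges of the subgraph `H` of `G*` isomorphic to the Petersen graph minus
a vertex. -/
def E1 : Set (Fin 36) := {e | e.val ≤ 11}

/-- `E₂`: the edges of `G*` belonging neither to `E₁` nor to a copy of `S₄`. -/
def E2 : Set (Fin 36) := {e | 12 ≤ e.val ∧ e.val ≤ 23}

/-- Three colors form the star of a vertex of `S₁₀`. -/
def IsStar (x y z : Fin 15) : Prop :=
  x ≠ y ∧ x ≠ z ∧ y ≠ z ∧ ∃ u, u ∈ S10.ends x ∧ u ∈ S10.ends y ∧ u ∈ S10.ends z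

theorem Multigraph.IsColoring.isStar {V E : Type} {G : Multigraph V E} {f : E → Fin 15}
    (hf : G.IsColoring S10 f) {v : V} {a b c : E} (ha : v ∈ G.ends a) (hb : v ∈ G.ends b)
    (hc : v ∈ G.ends c) (hab : a ≠ b) (hac : a ≠ c) (hbc : b ≠ c) :
    IsStar (f a) (f b) (f c) := by
  obtain ⟨hadj, hstar⟩ := hf
  obtain ⟨u, hu⟩ := hstar v
  have hmem : ∀ e, v ∈ G.ends e → u ∈ S10.ends (f e) := fun e he =>
    hu.subset (Set.mem_image_of_mem f he)
  exact ⟨hadj a b ⟨hab, v, ha, hb⟩, hadj a c ⟨hac, v, ha, hc⟩, hadj b c ⟨hbc, v, hb, hc⟩,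
    u, hmem a ha, hmem b hb, hmem c hc⟩

theorem mem_A1_iff {x : Fin 15} : x ∈ A1 ↔ 9 ≤ x := by
  revert x
  simp only [A1, Set.mem_insert_iff, Set.mem_singleton_iff]
  decide

set_option synthInstance.maxSize 2000 in
/-- A star of `S₁₀` never contains exactly one parallel edge. -/
theorem IsStar.lt_nine {x y z : Fin 15} (h : IsStar x y z) (hx : x < 9) (hy : y < 9) :
    z < 9 := by
  obtain ⟨hxy, hxz, hyz, u, hux, huy, huz⟩ := h
  have key : ∀ u x, u ∈ S10.ends x → x < 9 → ∀ y, u ∈ S10.ends y → y < 9 → x ≠ y →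
      ∀ z, u ∈ S10.ends z → x ≠ z → y ≠ z → z < 9 := by decide
  exact key u x hux hx y huy hy hxy z huz hxz hyz

/-- A star of `S₁₀` containing an edge at the centre contains no parallel edge. -/
theorem IsStar.lt_nine_of_lt_three {x y z : Fin 15} (h : IsStar x y z) (hx : x < 3) :
    y < 9 ∧ z < 9 := by
  obtain ⟨-, -, -, u, hux, huy, huz⟩ := h
  have key : ∀ u x, u ∈ S10.ends x → x < 3 → ∀ y, u ∈ S10.ends y → y < 9 := by decide
  exact ⟨key u x hux hx y huy, key u x hux hx z huz⟩

set_option synthInstance.maxSize 2000 in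
/-- Two distinct stars of `S₁₀` sharing two edges are those of the ends of a digon. -/
theorem IsStar.eq_of_shared {d d' a b : Fin 15} (h₁ : IsStar d d' a) (h₂ : IsStar d d' b)
    (hab : a ≠ b) : (a = 3 ∧ b = 4 ∨ a = 4 ∧ b = 3) ∨ (a = 5 ∧ b = 6 ∨ a = 6 ∧ b = 5) ∨
      (a = 7 ∧ b = 8 ∨ a = 8 ∧ b = 7) := by
  obtain ⟨hd, hda, hda', u, hud, hud', hua⟩ := h₁
  obtain ⟨-, hdb, hdb', v, hvd, hvd', hvb⟩ := h₂
  have key : ∀ u d, u ∈ S10.ends d → ∀ d', u ∈ S10.ends d' → d ≠ d' →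
      ∀ a, u ∈ S10.ends a → d ≠ a → d' ≠ a → ∀ v, v ∈ S10.ends d → v ∈ S10.ends d' →
      ∀ b, v ∈ S10.ends b → d ≠ b → d' ≠ b → a ≠ b →
      (a = 3 ∧ b = 4 ∨ a = 4 ∧ b = 3) ∨ (a = 5 ∧ b = 6 ∨ a = 6 ∧ b = 5) ∨
        (a = 7 ∧ b = 8 ∨ a = 8 ∧ b = 7) := by decide
  exact key u d hud d' hud' hd a hua hda hda' v hvd hvd' b hvb hdb hdb' hab

set_option synthInstance.maxSize 2000 in
/-- The edge leaving a copy of `S₄` is colored with an edge at the centre of `S₁₀`. -/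
theorem IsStar.pendant_lt_three {d d' a b p : Fin 15} (h₁ : IsStar d d' a)
    (h₂ : IsStar d d' b) (h₃ : IsStar a b p) : p < 3 := by
  have hab := h₁.eq_of_shared h₂ h₃.1
  obtain ⟨-, hap, hbp, u, hua, hub, hup⟩ := h₃
  have key : ∀ u p, u ∈ S10.ends p → ∀ a, u ∈ S10.ends a → a ≠ p →
      ∀ b, u ∈ S10.ends b → b ≠ p →
      ((a = 3 ∧ b = 4 ∨ a = 4 ∧ b = 3) ∨ (a = 5 ∧ b = 6 ∨ a = 6 ∧ b = 5) ∨
        (a = 7 ∧ b = 8 ∨ a = 8 ∧ b = 7)) → p < 3 := by decide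
  exact key u p hup a hua hap b hub hbp hab

/-- If `f` is an `S₁₀`-coloring of `G*`, then `f⁻¹(A₁) ∩ E₂ = ∅`. -/
theorem preimage_A1_misses_E2 (f : Fin 36 → Fin 15) (hf : Gstar.IsColoring S10 f) :
    (f ⁻¹' A1) ∩ E2 = ∅ := by
  have star (v : Fin 24) (a b c : Fin 36) (h : v ∈ Gstar.ends a ∧ v ∈ Gstar.ends b ∧
      v ∈ Gstar.ends c ∧ a ≠ b ∧ a ≠ c ∧ b ≠ c) : IsStar (f a) (f b) (f c) :=
    hf.isStar h.1 h.2.1 h.2.2.1 h.2.2.2.1 h.2.2.2.2.1 h.2.2.2.2.2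
  have h21 := (star 15 24 25 26 (by decide)).pendant_lt_three (star 16 24 25 27 (by decide))
    (star 17 26 27 21 (by decide))
  have h22 := (star 18 28 29 30 (by decide)).pendant_lt_three (star 19 28 29 31 (by decide))
    (star 20 30 31 22 (by decide))
  have h23 := (star 21 32 33 34 (by decide)).pendant_lt_three (star 22 32 33 35 (by decide))
    (star 23 34 35 23 (by decide))
  obtain ⟨h12, h18⟩ := (star 10 21 12 18 (by decide)).lt_nine_of_lt_three h21
  obtain ⟨h13, h19⟩ := (star 11 22 13 19 (by decide)).lt_nine_of_lt_three h22
  obtain ⟨h16, h17⟩ := (star 14 23 16 17 (by decide)).lt_nine_of_lt_three h23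
  have h14 := (star 9 12 13 14 (by decide)).lt_nine h12 h13
  have h15 := (star 12 14 17 15 (by decide)).lt_nine h14 h17
  have h20 := (star 13 15 16 20 (by decide)).lt_nine h15 h16
  ext e
  simp only [Set.mem_inter_iff, Set.mem_preimage, mem_A1_iff, Set.mem_empty_iff_false,
    iff_false, not_and]
  rintro he ⟨hl, hu⟩
  apply he.not_gt
  have h21' : f 21 < 9 := h21.trans (by decide)
  have h22' : f 22 < 9 := h22.trans (by decide)
  have h23' : f 23 < 9 := h23.trans (by decide)
  obtain ⟨n, hn⟩ := e
  dsimp only at hl hu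
  interval_cases n <;> assumption
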